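/- For n ∈ ℤ and c ∈ ℝ, let f_{n,c}(t) = e^{ict} for t ∈ (2^{−n−1}, 2^{−n}] and f_{n,c}(t) = 0 otherwise, and let F_{n,c}(z) = ∫₀^∞ e^{−zt} f_{n,c}(t) dt. Then: (i) if z = x + iy with 2^n ≤ x ≤ 2^{n+1} and |y − c| ≤ 2^n, then |F_{n,c}(z)| ≥ e^{−2}·cos(1)·2^{−n−1}; (ii) there is an absolute constant C > 0 such that for all m, n ∈ ℤ, all c ∈ ℝ, and all z with Re z ≥ 2^n, one has |F_{m,c}(z)| ≤ C·2^{−n−|n−m|}. -/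

import Mathlib

open MeasureTheory Set Complex Filter
open scoped ENNReal NNReal

noncomputable section

/-- The Laplace transform of `f : (0,∞) → ℂ`. -/
def laplace (f : ℝ → ℂ) (z : ℂ) : ℂ :=
  ∫ t in Ioi (0:ℝ), Complex.exp (-z * t) * f t

/-- The Laplace transform of `f : (0,τ) → ℂ`. -/
def laplaceOn (τ : ℝ) (f : ℝ → ℂ) (z : ℂ) : ℂ :=
  ∫ t in Ioo (0:ℝ) τ, Complex.exp (-z * t) * f t

/-- The Carleson square `Q_I` over the interval `I = i[a,b]` on the imaginary axis. -/
def carlesonSquare (a b : ℝ) : Set ℂ :=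
  {z : ℂ | z.im ∈ Icc a b ∧ z.re ∈ Ioo 0 (b - a)}

/-- The `α`-Carleson intensity of a measure on the right half-plane. -/
def carlesonIntensity (α : ℝ) (ν : Measure ℂ) : ℝ≥0∞ :=
  ⨆ (a : ℝ) (b : ℝ) (_ : a < b),
    ν (carlesonSquare a b) / ENNReal.ofReal ((b - a) ^ α)

/-- The dyadic strip `S_n = {2^n ≤ Re z < 2^(n+1)}`. -/
def dyadicStrip (n : ℤ) : Set ℂ :=
  {z : ℂ | (2:ℝ) ^ n ≤ z.re ∧ z.re < (2:ℝ) ^ (n + 1)}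

/-- `μ_n`, the restriction of `μ` to the dyadic strip `S_n`. -/
def stripPart (μ : Measure ℂ) (n : ℤ) : Measure ℂ := μ.restrict (dyadicStrip n)

/-- A Young function: increasing, continuous, convex on `[0,∞)`, with
`Φ(t)/t → 0` as `t → 0⁺` and `Φ(t)/t → ∞` as `t → ∞`. -/
def YoungFunction (Φ : ℝ → ℝ) : Prop :=
  (∀ t, 0 ≤ t → 0 ≤ Φ t) ∧ MonotoneOn Φ (Ici 0) ∧ ContinuousOn Φ (Ici 0) ∧
    ConvexOn ℝ (Ici 0) Φ ∧
    Tendsto (fun t => Φ t / t) (nhdsWithin 0 (Ioi 0)) (nhds 0) ∧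
    Tendsto (fun t => Φ t / t) atTop atTop

/-- The Luxemburg (Orlicz) norm of `f` on `J` w.r.t. the Young function `Φ`. -/
def luxNorm (Φ : ℝ → ℝ) (J : Set ℝ) (f : ℝ → ℂ) : ℝ≥0∞ :=
  ⨅ (k : ℝ) (_ : 0 < k)
    (_ : (∫⁻ s in J, ENNReal.ofReal (Φ (‖f s‖ / k))) ≤ 1), ENNReal.ofReal k

/-- The complementary Young function `Φᶜ(s) = sup_{t ≥ 0} (st - Φ(t))`. -/
def youngConj (Φ : ℝ → ℝ) (s : ℝ) : ℝ :=
  sSup {u : ℝ | ∃ t : ℝ, 0 ≤ t ∧ u = s * t - Φ t}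

/-- `F_{n,c}`, the Laplace transform of `f_{n,c}(t) = e^{ict} 1_{(2^{-n-1}, 2^{-n}]}(t)`. -/
def Fnc (n : ℤ) (c : ℝ) (z : ℂ) : ℂ :=
  ∫ t in Ioc ((2:ℝ) ^ (-n - 1)) ((2:ℝ) ^ (-n)),
    Complex.exp (-z * t) * Complex.exp (Complex.I * c * t)

lemma norm_exp_neg_mul_mul_exp (c : ℝ) (z : ℂ) (t : ℝ) :
    ‖Complex.exp (-z * t) * Complex.exp (Complex.I * c * t)‖ = Real.exp (-(z.re * t)) := by
  simp [← Complex.exp_add, Complex.norm_exp]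

lemma re_exp_neg_mul_mul_exp (c : ℝ) (z : ℂ) (t : ℝ) :
    (Complex.exp (-z * t) * Complex.exp (Complex.I * c * t)).re =
      Real.exp (-(z.re * t)) * Real.cos ((z.im - c) * t) := by
  rw [← Complex.exp_add, Complex.exp_re, ← Real.cos_neg]
  simp
  congr 1
  ring

lemma volume_real_dyadic (n : ℤ) :
    volume.real (Ioc ((2:ℝ) ^ (-n - 1)) ((2:ℝ) ^ (-n))) = (2:ℝ) ^ (-n - 1) := by
  have h : (2:ℝ) ^ (-n) = 2 * (2:ℝ) ^ (-n - 1) := by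
    rw [← zpow_one_add₀ two_ne_zero]; congr 1; ring
  have := zpow_pos (two_pos (α := ℝ)) (-n - 1)
  rw [Real.volume_real_Ioc_of_le (by linarith), h]
  ring

lemma le_norm_Fnc {n : ℤ} {c : ℝ} {z : ℂ} (hz : z.re ≤ (2:ℝ) ^ (n + 1)) (hc : |z.im - c| ≤ (2:ℝ) ^ n) :
    Real.exp (-2) * Real.cos 1 * (2:ℝ) ^ (-n - 1) ≤ ‖Fnc n c z‖ := by
  have hint : IntegrableOn
      (fun t : ℝ => Complex.exp (-z * t) * Complex.exp (Complex.I * c * t))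
      (Ioc ((2:ℝ) ^ (-n - 1)) ((2:ℝ) ^ (-n))) :=
    (Continuous.integrableOn_Icc (by fun_prop)).mono_set Ioc_subset_Icc_self
  refine le_trans ?_ (Complex.re_le_norm _)
  have hre : (Fnc n c z).re = ∫ t in Ioc ((2:ℝ) ^ (-n - 1)) ((2:ℝ) ^ (-n)),
      (Complex.exp (-z * t) * Complex.exp (Complex.I * c * t)).re :=
    (integral_re hint).symm
  rw [hre]
  refine (congrArg _ (volume_real_dyadic n)).ge.trans <|
    setIntegral_ge_of_const_le_real measurableSet_Ioc measure_Ioc_lt_top.ne ?_ hint.re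
  rintro t ⟨ht₁, ht₂⟩
  have ht : 0 < t := (zpow_pos two_pos _).trans ht₁
  have hone : (2:ℝ) ^ n * (2:ℝ) ^ (-n) = 1 := by
    rw [← zpow_add₀ two_ne_zero]; simp
  have hxt : z.re * t ≤ 2 := calc
    z.re * t ≤ (2:ℝ) ^ (n + 1) * (2:ℝ) ^ (-n) := by gcongr
    _ = 2 := by rw [zpow_add_one₀ two_ne_zero]; linarith
  have hyt : |(z.im - c) * t| ≤ 1 := by
    rw [abs_mul, abs_of_pos ht, ← hone]
    gcongr
  have hcos : Real.cos 1 ≤ Real.cos ((z.im - c) * t) := by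
    rw [← Real.cos_abs ((z.im - c) * t)]
    exact Real.cos_le_cos_of_nonneg_of_le_pi (abs_nonneg _)
      (by linarith [Real.pi_gt_three]) hyt
  rw [re_exp_neg_mul_mul_exp]
  have := Real.cos_one_pos
  gcongr

lemma norm_Fnc_le {m : ℤ} {c b : ℝ} {z : ℂ} (hb : 0 ≤ b) (hz : b ≤ z.re) :
    ‖Fnc m c z‖ ≤ Real.exp (-(b * (2:ℝ) ^ (-m - 1))) * (2:ℝ) ^ (-m - 1) := by
  refine (norm_setIntegral_le_of_norm_le_const measure_Ioc_lt_top ?_).trans_eq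
    (congrArg _ (volume_real_dyadic m))
  rintro t ⟨ht, -⟩
  rw [norm_exp_neg_mul_mul_exp]
  have := zpow_pos (two_pos (α := ℝ)) (-m - 1)
  have := hb.trans hz
  gcongr

lemma exp_neg_le_two_div_sq {u : ℝ} (hu : 0 < u) : Real.exp (-u) ≤ 2 / u ^ 2 := by
  rw [Real.exp_neg, ← inv_div]
  have := Real.quadratic_le_exp_of_nonneg hu.le
  gcongr
  linarith

lemma norm_Fnc_le_decay {m n : ℤ} {c : ℝ} {z : ℂ} (hz : (2:ℝ) ^ n ≤ z.re) :
    ‖Fnc m c z‖ ≤ 4 * (2:ℝ) ^ (-n - |n - m|) := by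
  have hb := zpow_pos (two_pos (α := ℝ)) n
  have ha := zpow_pos (two_pos (α := ℝ)) (-m - 1)
  refine (norm_Fnc_le hb.le hz).trans ?_
  rcases le_total n m with h | h
  · rw [abs_of_nonpos (by lia)]
    have hexp : Real.exp (-((2:ℝ) ^ n * (2:ℝ) ^ (-m - 1))) ≤ 4 :=
      (Real.exp_le_one_iff.2 (by simp only [Left.neg_nonpos_iff]; positivity)).trans
        (by norm_num)
    exact mul_le_mul hexp (zpow_le_zpow_right₀ one_le_two (by lia)) ha.le zero_le_four
  · rw [abs_of_nonneg (by lia)]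
    calc _ ≤ 2 / ((2:ℝ) ^ n * (2:ℝ) ^ (-m - 1)) ^ 2 * (2:ℝ) ^ (-m - 1) := by
          gcongr
          exact exp_neg_le_two_div_sq (by positivity)
      _ = 4 * (2:ℝ) ^ (-n - (n - m)) := by
          rw [show -n - (n - m) = m - n - n by ring]
          simp only [zpow_sub₀ (two_ne_zero (α := ℝ)), zpow_neg, zpow_one]
          field_simp
          norm_num

/-- localization estimates for `F_{n,c}`:
(i) if `2^n ≤ Re z ≤ 2^{n+1}` and `|Im z − c| ≤ 2^n`, then
`|F_{n,c}(z)| ≥ e^{−2} cos(1) 2^{−n−1}`;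
(ii) there is an absolute `C > 0` with `|F_{m,c}(z)| ≤ C 2^{−n−|n−m|}` whenever
`Re z ≥ 2^n`. -/
theorem Fnc_localization :
    (∀ (n : ℤ) (c : ℝ) (z : ℂ),
        (2:ℝ) ^ n ≤ z.re → z.re ≤ (2:ℝ) ^ (n + 1) → |z.im - c| ≤ (2:ℝ) ^ n →
        Real.exp (-2) * Real.cos 1 * (2:ℝ) ^ (-n - 1) ≤ ‖Fnc n c z‖) ∧
    (∃ C : ℝ, 0 < C ∧
      ∀ (m n : ℤ) (c : ℝ) (z : ℂ), (2:ℝ) ^ n ≤ z.re →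
        ‖Fnc m c z‖ ≤ C * (2:ℝ) ^ (-n - |n - m|)) := by
  exact ⟨fun _ _ _ _ hz hc => le_norm_Fnc hz hc,
    4, four_pos, fun _ _ _ _ hz => norm_Fnc_le_decay hz⟩
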